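/- arXiv:2402.07737 — 3 statements merged into one kernel-verified Lean document; each statement's English description precedes it below -/
import Mathlib

section
/- Let v₁, …, v₆ ∈ ℂ³ be a realisation of the quadrilateral set, i.e. det(v₁,v₂,v₃) = det(v₁,v₅,v₆) = det(v₂,v₄,v₆) = det(v₃,v₄,v₅) = 0 and det(v_a,v_b,v_c) ≠ 0 for every other triple a < b < c in {1,…,6}. Then for all P¹, P², P³ ∈ ℂ³ the following four identities hold: det(v₁,v₅,P¹)det(v₂,v₆,P²)det(v₃,v₄,P³) = det(v₁,v₆,P¹)det(v₂,v₄,P²)det(v₃,v₅,P³); det(v₁,v₂,P¹)det(v₅,v₃,P²)det(v₆,v₄,P³) = det(v₁,v₃,P¹)det(v₅,v₄,P²)det(v₆,v₂,P³); det(v₂,v₁,P¹)det(v₄,v₃,P²)det(v₆,v₅,P³) = det(v₂,v₃,P¹)det(v₄,v₅,P²)det(v₆,v₁,P³); det(v₃,v₁,P¹)det(v₄,v₂,P²)det(v₅,v₆,P³) = det(v₃,v₂,P¹)det(v₄,v₆,P²)det(v₅,v₁,P³). That is, the polynomial QS(ℓ; P¹,P²,P³) vanishes for each of the four lines ℓ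 of the quadrilateral set. -/
/-- The determinant of the 3×3 matrix with rows `u`, `v`, `w`. -/
noncomputable def det3 (u v w : Fin 3 → ℂ) : ℂ := Matrix.det (Matrix.of ![u, v, w])

/-- The four lines of the quadrilateral set, on points `0,…,5`
(written `1,…,6` in the paper): `{1,2,3}, {1,5,6}, {2,4,6}, {3,4,5}`. -/
def qsLines : Finset (Finset (Fin 6)) := {{0, 1, 2}, {0, 4, 5}, {1, 3, 5}, {2, 3, 4}}

theorem det3_expand (u v w : Fin 3 → ℂ) :
    det3 u v w = u 0 * v 1 * w 2 - u 0 * v 2 * w 1 - u 1 * v 0 * w 2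
      + u 1 * v 2 * w 0 + u 2 * v 0 * w 1 - u 2 * v 1 * w 0 := by
  simp [det3, Matrix.det_fin_three]

theorem det3_cramer (a d e f : Fin 3 → ℂ) :
    det3 d e f • a = det3 a e f • d + det3 d a f • e + det3 d e a • f := by
  ext i
  fin_cases i <;> simp [det3_expand] <;> ring

/-- A vector coplanar with two members of a basis of `ℂ³` is a linear combination of them. -/
theorem exists_eq_smul_add_smul_of_det3_eq_zero {a d e f : Fin 3 → ℂ}
    (hdef : det3 d e f ≠ 0) (h : det3 a e f = 0) : ∃ x y : ℂ, a = x • e + y • f := by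
  refine ⟨(det3 d e f)⁻¹ * det3 d a f, (det3 d e f)⁻¹ * det3 d e a, ?_⟩
  rw [mul_smul, mul_smul, ← smul_add, eq_inv_smul_iff₀ hdef, det3_cramer, h, zero_smul, zero_add]

/-- The quadrilateral set identity for the line through `a`, `b`, `c`, whose complementary
points `d`, `e`, `f` form a basis. -/
theorem quadrilateral_identity {a b c d e f : Fin 3 → ℂ} (hdef : det3 d e f ≠ 0)
    (habc : det3 a b c = 0) (haef : det3 a e f = 0) (hbdf : det3 b d f = 0)
    (hcde : det3 c d e = 0) (P₁ P₂ P₃ : Fin 3 → ℂ) :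
    det3 a e P₁ * det3 b f P₂ * det3 c d P₃ = det3 a f P₁ * det3 b d P₂ * det3 c e P₃ := by
  have hedf : det3 e d f ≠ 0 := by
    rwa [show det3 e d f = -det3 d e f by simp only [det3_expand]; ring, neg_ne_zero]
  have hfde : det3 f d e ≠ 0 := by
    rwa [show det3 f d e = det3 d e f by simp only [det3_expand]; ring]
  obtain ⟨x₁, y₁, rfl⟩ := exists_eq_smul_add_smul_of_det3_eq_zero hdef haef
  obtain ⟨x₂, y₂, rfl⟩ := exists_eq_smul_add_smul_of_det3_eq_zero hedf hbdf
  obtain ⟨x₃, y₃, rfl⟩ := exists_eq_smul_add_smul_of_det3_eq_zero hfde hcde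
  have hcoef : x₁ * y₂ * x₃ + y₁ * x₂ * y₃ = 0 := by
    refine (mul_eq_zero.mp (Eq.trans ?_ habc)).resolve_right hdef
    simp only [det3_expand, Pi.add_apply, Pi.smul_apply, smul_eq_mul]
    ring
  have left_self (x y : ℂ) (u w P : Fin 3 → ℂ) :
      det3 (x • u + y • w) u P = -y * det3 u w P := by
    simp only [det3_expand, Pi.add_apply, Pi.smul_apply, smul_eq_mul]
    ring
  have right_self (x y : ℂ) (u w P : Fin 3 → ℂ) :
      det3 (x • u + y • w) w P = x * det3 u w P := by
    simp only [det3_expand, Pi.add_apply, Pi.smul_apply, smul_eq_mul]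
    ring
  simp only [left_self, right_self]
  linear_combination det3 e f P₁ * det3 d f P₂ * det3 d e P₃ * hcoef

/-- If `v₁,…,v₆ ∈ ℂ³` is a realisation of the quadrilateral set, then for all
`P¹, P², P³ ∈ ℂ³` the polynomial `QS(ℓ; P¹, P², P³)` vanishes for each of the four
lines `ℓ` of the quadrilateral set. -/
theorem stmt9 (v : Fin 6 → Fin 3 → ℂ)
    (h123 : det3 (v 0) (v 1) (v 2) = 0)
    (h156 : det3 (v 0) (v 4) (v 5) = 0)
    (h246 : det3 (v 1) (v 3) (v 5) = 0)
    (h345 : det3 (v 2) (v 3) (v 4) = 0)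
    (hother : ∀ a b c : Fin 6, a < b → b < c →
      ({a, b, c} : Finset (Fin 6)) ∉ qsLines → det3 (v a) (v b) (v c) ≠ 0) :
    ∀ P₁ P₂ P₃ : Fin 3 → ℂ,
      (det3 (v 0) (v 4) P₁ * det3 (v 1) (v 5) P₂ * det3 (v 2) (v 3) P₃ =
        det3 (v 0) (v 5) P₁ * det3 (v 1) (v 3) P₂ * det3 (v 2) (v 4) P₃) ∧
      (det3 (v 0) (v 1) P₁ * det3 (v 4) (v 2) P₂ * det3 (v 5) (v 3) P₃ =
        det3 (v 0) (v 2) P₁ * det3 (v 4) (v 3) P₂ * det3 (v 5) (v 1) P₃) ∧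
      (det3 (v 1) (v 0) P₁ * det3 (v 3) (v 2) P₂ * det3 (v 5) (v 4) P₃ =
        det3 (v 1) (v 2) P₁ * det3 (v 3) (v 4) P₂ * det3 (v 5) (v 0) P₃) ∧
      (det3 (v 2) (v 0) P₁ * det3 (v 3) (v 1) P₂ * det3 (v 4) (v 5) P₃ =
        det3 (v 2) (v 1) P₁ * det3 (v 3) (v 5) P₂ * det3 (v 4) (v 0) P₃) := by
  have n456 := hother 3 4 5 (by decide) (by decide) (by decide)
  have n234 := hother 1 2 3 (by decide) (by decide) (by decide)
  have n135 := hother 0 2 4 (by decide) (by decide) (by decide)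
  have n126 := hother 0 1 5 (by decide) (by decide) (by decide)
  intro P₁ P₂ P₃
  refine ⟨quadrilateral_identity n456 h123 h156 h246 h345 P₁ P₂ P₃,
    quadrilateral_identity (d := v 3) ?_ h156 h123 ?_ ?_ P₁ P₂ P₃,
    quadrilateral_identity (d := v 4) ?_ h246 ?_ ?_ ?_ P₁ P₂ P₃,
    quadrilateral_identity (d := v 5) ?_ h345 ?_ ?_ ?_ P₁ P₂ P₃⟩
  all_goals simp only [det3_expand] at *; grind
end

section
/- Let x : Fin 6 → ℂ be injective (indices written 1,…,6) and set v_t = (x_t, 1, 0) ∈ ℂ³, six distinct collinear points. Then the following are equivalent: (i) there exists z : Fin 6 → ℂ such that the vectors w_t = (x_t, 1, z_t) form a realisation of the quadrilateral set, i.e. det(w_a,w_b,w_c) = 0 exactly for the triples {1,2,3}, {1,5,6}, {2,4,6}, {3,4,5}; (ii) for each of the four lines ℓ ∈ {ℓ₁₂₃, ℓ₁₅₆, ℓ₂₄₆, ℓ₃₄₅} and all P¹, P², P³ ∈ ℂ³, the polynomial QS(ℓ; P¹,P²,P³) evaluated at v₁,…,v₆ vanishes. -/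
theorem det3_lift (a b c p q r : ℂ) :
    det3 ![a, 1, p] ![b, 1, q] ![c, 1, r] = p * (b - c) + q * (c - a) + r * (a - b) := by
  simp [det3, Matrix.det_fin_three]
  ring

theorem det3_planar (a b : ℂ) (P : Fin 3 → ℂ) :
    det3 ![a, 1, 0] ![b, 1, 0] P = (a - b) * P 2 := by
  simp [det3, Matrix.det_fin_three]
  ring

/-- A property of triples of indices invariant under transpositions need only be checked on
increasing triples. -/
theorem forall_distinct_of_increasing {α : Type*} [LinearOrder α] {Q : α → α → α → Prop}
    (swap_left : ∀ a b c, Q a b c → Q b a c) (swap_right : ∀ a b c, Q a b c → Q a c b)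
    (h : ∀ a b c, a < b → b < c → Q a b c) (a b c : α) (hab : a ≠ b) (hac : a ≠ c)
    (hbc : b ≠ c) : Q a b c := by
  rcases hab.lt_or_gt with hab | hab <;> rcases hac.lt_or_gt with hac | hac <;>
    rcases hbc.lt_or_gt with hbc | hbc <;> grind

/-- The lift of six collinear points with first coordinates `x` in which the points of the line
`{0, 1, 2}` stay in place. -/
def quadLift (x : Fin 6 → ℂ) : Fin 6 → ℂ :=
  ![0, 0, 0, (x 1 - x 3) * (x 0 - x 5), (x 1 - x 5) * (x 0 - x 4), (x 1 - x 5) * (x 0 - x 5)]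

theorem quadLift_realises (x : Fin 6 → ℂ) (hx : Function.Injective x)
    (h : (x 0 - x 4) * (x 1 - x 5) * (x 2 - x 3) = (x 0 - x 5) * (x 1 - x 3) * (x 2 - x 4))
    (a b c : Fin 6) (hab : a ≠ b) (hac : a ≠ c) (hbc : b ≠ c) :
    det3 ![x a, 1, quadLift x a] ![x b, 1, quadLift x b] ![x c, 1, quadLift x c] = 0 ↔
      ({a, b, c} : Finset (Fin 6)) ∈ qsLines := by
  revert a b c
  have hne (i j : Fin 6) (hij : i ≠ j) : x i - x j ≠ 0 := sub_ne_zero.mpr (hx.ne hij)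
  refine forall_distinct_of_increasing (fun a b c hQ => ?_) (fun a b c hQ => ?_) ?_
  · rw [Finset.insert_comm, ← hQ, det3_lift, det3_lift, ← neg_eq_zero]
    ring_nf
  · rw [Finset.pair_comm, ← hQ, det3_lift, det3_lift, ← neg_eq_zero]
    ring_nf
  have on_line {p : ℂ} {L : Finset (Fin 6)} (hL : L ∈ qsLines) (hp : p = 0) :
      p = 0 ↔ L ∈ qsLines := iff_of_true hp hL
  have off_line {p : ℂ} {L : Finset (Fin 6)} (i j k l m n : Fin 6) (hL : L ∉ qsLines)
      (hij : i ≠ j) (hkl : k ≠ l) (hmn : m ≠ n)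
      (hp : p = (x i - x j) * (x k - x l) * (x m - x n)) :
      p = 0 ↔ L ∈ qsLines :=
    iff_of_false (hp ▸ mul_ne_zero (mul_ne_zero (hne i j hij) (hne k l hkl)) (hne m n hmn)) hL
  have increasing (Q : Fin 6 → Fin 6 → Fin 6 → Prop)
      (h₀ : Q 0 1 2 ∧ Q 0 1 3 ∧ Q 0 1 4 ∧ Q 0 1 5 ∧ Q 0 2 3 ∧ Q 0 2 4 ∧ Q 0 2 5 ∧
        Q 0 3 4 ∧ Q 0 3 5 ∧ Q 0 4 5)
      (h₁ : Q 1 2 3 ∧ Q 1 2 4 ∧ Q 1 2 5 ∧ Q 1 3 4 ∧ Q 1 3 5 ∧ Q 1 4 5)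
      (h₂ : Q 2 3 4 ∧ Q 2 3 5 ∧ Q 2 4 5 ∧ Q 3 4 5) (a b c : Fin 6) (hab : a < b)
      (hbc : b < c) : Q a b c := by
    obtain ⟨_, _, _, _, _, _, _, _, _, _⟩ := h₀
    obtain ⟨_, _, _, _, _, _⟩ := h₁
    obtain ⟨_, _, _, _⟩ := h₂
    fin_cases a <;> fin_cases b <;> first
      | exact absurd hab (by decide)
      | fin_cases c <;> first
        | exact absurd hbc (by decide)
        | assumption
  refine increasing _ ⟨?_, ?_, ?_, ?_, ?_, ?_, ?_, ?_, ?_, ?_⟩ ⟨?_, ?_, ?_, ?_, ?_, ?_⟩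
    ⟨?_, ?_, ?_, ?_⟩
  · exact on_line (by decide) (by rw [det3_lift]; simp [quadLift])
  · exact off_line 1 3 0 5 0 1 (by decide) (by decide) (by decide) (by decide)
      (by rw [det3_lift]; simp [quadLift])
  · exact off_line 1 5 0 4 0 1 (by decide) (by decide) (by decide) (by decide)
      (by rw [det3_lift]; simp [quadLift])
  · exact off_line 1 5 0 5 0 1 (by decide) (by decide) (by decide) (by decide)
      (by rw [det3_lift]; simp [quadLift])
  · exact off_line 1 3 0 5 0 2 (by decide) (by decide) (by decide) (by decide)
      (by rw [det3_lift]; simp [quadLift])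
  · exact off_line 1 5 0 4 0 2 (by decide) (by decide) (by decide) (by decide)
      (by rw [det3_lift]; simp [quadLift])
  · exact off_line 1 5 0 5 0 2 (by decide) (by decide) (by decide) (by decide)
      (by rw [det3_lift]; simp [quadLift])
  · exact off_line 0 4 0 1 3 5 (by decide) (by decide) (by decide) (by decide)
      (by rw [det3_lift]; simp [quadLift]; ring)
  · exact off_line 0 5 0 1 3 5 (by decide) (by decide) (by decide) (by decide)
      (by rw [det3_lift]; simp [quadLift]; ring)
  · exact on_line (by decide) (by rw [det3_lift]; simp [quadLift]; ring)
  · exact off_line 1 3 0 5 1 2 (by decide) (by decide) (by decide) (by decide)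
      (by rw [det3_lift]; simp [quadLift])
  · exact off_line 1 5 0 4 1 2 (by decide) (by decide) (by decide) (by decide)
      (by rw [det3_lift]; simp [quadLift])
  · exact off_line 1 5 0 5 1 2 (by decide) (by decide) (by decide) (by decide)
      (by rw [det3_lift]; simp [quadLift])
  · exact off_line 1 3 0 1 4 5 (by decide) (by decide) (by decide) (by decide)
      (by rw [det3_lift]; simp [quadLift]; ring)
  · exact on_line (by decide) (by rw [det3_lift]; simp [quadLift]; ring)
  · exact off_line 1 5 0 1 5 4 (by decide) (by decide) (by decide) (by decide)
      (by rw [det3_lift]; simp [quadLift]; ring)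
  · exact on_line (by decide) (by rw [det3_lift]; simp [quadLift]; linear_combination h)
  · exact off_line 0 5 1 2 5 3 (by decide) (by decide) (by decide) (by decide)
      (by rw [det3_lift]; simp [quadLift]; ring)
  · exact off_line 1 5 0 2 5 4 (by decide) (by decide) (by decide) (by decide)
      (by rw [det3_lift]; simp [quadLift]; ring)
  · exact off_line 4 5 0 1 5 3 (by decide) (by decide) (by decide) (by decide)
      (by rw [det3_lift]; simp [quadLift]; ring)

theorem quad_relation_of_proportional {p q r a b c d e f : ℂ} (hne : p * q * r ≠ 0)
    (h₁ : q * b = r * a) (h₂ : r * d = p * c) (h₃ : p * f = q * e) :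
    a * c * e = b * d * f := by
  refine mul_left_cancel₀ hne ?_
  linear_combination (-r * d * p * f) * h₁ - r * a * p * f * h₂ - r * a * p * c * h₃

theorem quad_relation_of_lift (x z : Fin 6 → ℂ)
    (hz : ∀ a b c : Fin 6, a ≠ b → a ≠ c → b ≠ c →
      (det3 ![x a, 1, z a] ![x b, 1, z b] ![x c, 1, z c] = 0 ↔
        ({a, b, c} : Finset (Fin 6)) ∈ qsLines)) :
    (x 0 - x 4) * (x 1 - x 5) * (x 2 - x 3) = (x 0 - x 5) * (x 1 - x 3) * (x 2 - x 4) := by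
  simp only [det3_lift] at hz
  have h012 := (hz 0 1 2 (by decide) (by decide) (by decide)).2 (by decide)
  have h045 := (hz 0 4 5 (by decide) (by decide) (by decide)).2 (by decide)
  have h135 := (hz 1 3 5 (by decide) (by decide) (by decide)).2 (by decide)
  have h234 := (hz 2 3 4 (by decide) (by decide) (by decide)).2 (by decide)
  have h013 := (hz 0 1 3 (by decide) (by decide) (by decide)).not.2 (by decide)
  have h014 := (hz 0 1 4 (by decide) (by decide) (by decide)).not.2 (by decide)
  have h015 := (hz 0 1 5 (by decide) (by decide) (by decide)).not.2 (by decide)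
  refine quad_relation_of_proportional (mul_ne_zero (mul_ne_zero h013 h014) h015) ?_ ?_ ?_
  · linear_combination (x 1 - x 0) * h045
  · linear_combination (x 0 - x 1) * h135
  · linear_combination (x 1 - x 0) * h234 + (x 3 - x 4) * h012

/-- Six distinct collinear points `vₜ = (xₜ, 1, 0)` lift to a realisation of the
quadrilateral set iff all the `QS` polynomials of the four lines vanish. -/
theorem stmt10 (x : Fin 6 → ℂ) (hx : Function.Injective x)
    (v : Fin 6 → Fin 3 → ℂ) (hv : ∀ t, v t = ![x t, 1, 0]) :
    (∃ z : Fin 6 → ℂ,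
      ∀ a b c : Fin 6, a ≠ b → a ≠ c → b ≠ c →
        (det3 ![x a, 1, z a] ![x b, 1, z b] ![x c, 1, z c] = 0 ↔
          ({a, b, c} : Finset (Fin 6)) ∈ qsLines)) ↔
    (∀ P₁ P₂ P₃ : Fin 3 → ℂ,
      (det3 (v 0) (v 4) P₁ * det3 (v 1) (v 5) P₂ * det3 (v 2) (v 3) P₃ -
        det3 (v 0) (v 5) P₁ * det3 (v 1) (v 3) P₂ * det3 (v 2) (v 4) P₃ = 0) ∧
      (det3 (v 0) (v 1) P₁ * det3 (v 4) (v 2) P₂ * det3 (v 5) (v 3) P₃ -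
        det3 (v 0) (v 2) P₁ * det3 (v 4) (v 3) P₂ * det3 (v 5) (v 1) P₃ = 0) ∧
      (det3 (v 1) (v 0) P₁ * det3 (v 3) (v 2) P₂ * det3 (v 5) (v 4) P₃ -
        det3 (v 1) (v 2) P₁ * det3 (v 3) (v 4) P₂ * det3 (v 5) (v 0) P₃ = 0) ∧
      (det3 (v 2) (v 0) P₁ * det3 (v 3) (v 1) P₂ * det3 (v 4) (v 5) P₃ -
        det3 (v 2) (v 1) P₁ * det3 (v 3) (v 5) P₂ * det3 (v 4) (v 0) P₃ = 0)) := by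
  trans (x 0 - x 4) * (x 1 - x 5) * (x 2 - x 3) = (x 0 - x 5) * (x 1 - x 3) * (x 2 - x 4)
  · exact ⟨fun ⟨z, hz⟩ => quad_relation_of_lift x z hz,
      fun h => ⟨quadLift x, quadLift_realises x hx h⟩⟩
  · simp only [hv, det3_planar]
    refine ⟨fun h P₁ P₂ P₃ => ⟨?_, ?_, ?_, ?_⟩, fun h => ?_⟩
    · linear_combination P₁ 2 * P₂ 2 * P₃ 2 * h
    · linear_combination P₁ 2 * P₂ 2 * P₃ 2 * h
    · linear_combination -P₁ 2 * P₂ 2 * P₃ 2 * h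
    · linear_combination P₁ 2 * P₂ 2 * P₃ 2 * h
    · have h₁ := (h ![0, 0, 1] ![0, 0, 1] ![0, 0, 1]).1
      simp only [Matrix.cons_val, mul_one] at h₁
      linear_combination h₁
end

section
/- Let x : Fin 6 → ℂ be injective (indices written 1,…,6) and set v_t = (x_t, 1, 0) ∈ ℂ³. Then there exists z : Fin 6 → ℂ such that the vectors w_t = (x_t, 1, z_t) form a realisation of the quadrilateral set (det(w_a,w_b,w_c) = 0 exactly for the triples {1,2,3}, {1,5,6}, {2,4,6}, {3,4,5}) if and only if the ten polynomials QS(ℓ₁₂₃; e_i, e_j, e_k) = det(v₁,v₅,e_i)det(v₂,v₆,e_j)det(v₃,v₄,e_k) − det(v₁,v₆,e_i)det(v₂,v₄,e_j)det(v₃,v₅,e_k) vanish for all 1 ≤ i ≤ j ≤ k ≤ 3, where e₁, e₂, e₃ is the standard basis of ℂ³. -/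
/-- The standard basis vectors `e₁, e₂, e₃` of `ℂ³`. -/
noncomputable def stdBasis (i : Fin 3) : Fin 3 → ℂ := Pi.single i 1

theorem det3_affine (a b c p q r : ℂ) :
    det3 ![a, 1, p] ![b, 1, q] ![c, 1, r] = (a - b) * (r - q) - (b - c) * (q - p) := by
  simp [det3, Matrix.det_fin_three]
  ring

theorem det3_swap_left (u v w : Fin 3 → ℂ) : det3 u v w = -det3 v u w := by
  simp [det3, Matrix.det_fin_three]
  ring

theorem det3_swap_right (u v w : Fin 3 → ℂ) : det3 u v w = -det3 u w v := by
  simp [det3, Matrix.det_fin_three]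
  ring

theorem det3_collinear_stdBasis (a b : ℂ) (i : Fin 3) :
    det3 ![a, 1, 0] ![b, 1, 0] (stdBasis i) = if i = 2 then a - b else 0 := by
  fin_cases i <;> simp [det3, stdBasis, Matrix.det_fin_three]

/-- A symmetric property of triples of distinct indices may be checked on increasing ones. -/
theorem forall_distinct_of_forall_lt {α : Type*} [LinearOrder α] {P : α → α → α → Prop}
    (hl : ∀ a b c, P a b c → P b a c) (hr : ∀ a b c, P a b c → P a c b)
    (h : ∀ a b c, a < b → b < c → P a b c) (a b c : α) (hab : a ≠ b) (hac : a ≠ c)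
    (hbc : b ≠ c) : P a b c := by
  rcases hab.lt_or_gt with h₁ | h₁ <;> rcases hac.lt_or_gt with h₂ | h₂ <;>
    rcases hbc.lt_or_gt with h₃ | h₃
  · exact h _ _ _ h₁ h₃
  · exact hr _ _ _ (h _ _ _ h₂ h₃)
  · exact absurd (h₁.trans h₃) h₂.asymm
  · exact hr _ _ _ (hl _ _ _ (h _ _ _ h₂ h₁))
  · exact hl _ _ _ (h _ _ _ h₁ h₂)
  · exact absurd (h₃.trans h₁) h₂.asymm
  · exact hl _ _ _ (hr _ _ _ (h _ _ _ h₃ h₂))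
  · exact hl _ _ _ (hr _ _ _ (hl _ _ _ (h _ _ _ h₃ h₁)))

/-- The ten quadrilateral-set polynomials reduce to a single equation between differences
of the coordinates. -/
theorem forall_qs_eq_zero_iff (x : Fin 6 → ℂ) (v : Fin 6 → Fin 3 → ℂ)
    (hv : ∀ t, v t = ![x t, 1, 0]) :
    (∀ i j k : Fin 3, i ≤ j → j ≤ k →
      det3 (v 0) (v 4) (stdBasis i) * det3 (v 1) (v 5) (stdBasis j) *
          det3 (v 2) (v 3) (stdBasis k) -
        det3 (v 0) (v 5) (stdBasis i) * det3 (v 1) (v 3) (stdBasis j) *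
          det3 (v 2) (v 4) (stdBasis k) = 0) ↔
      (x 0 - x 4) * (x 1 - x 5) * (x 2 - x 3) = (x 0 - x 5) * (x 1 - x 3) * (x 2 - x 4) := by
  simp only [hv, det3_collinear_stdBasis]
  constructor
  · intro h
    simpa [sub_eq_zero] using h 2 2 2 le_rfl le_rfl
  · intro h i j k _ _
    split_ifs <;> simp [h]

theorem quadrilateral_eq_of_lift (x z : Fin 6 → ℂ)
    (h₀₁₂ : det3 ![x 0, 1, z 0] ![x 1, 1, z 1] ![x 2, 1, z 2] = 0)
    (h₀₄₅ : det3 ![x 0, 1, z 0] ![x 4, 1, z 4] ![x 5, 1, z 5] = 0)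
    (h₁₃₅ : det3 ![x 1, 1, z 1] ![x 3, 1, z 3] ![x 5, 1, z 5] = 0)
    (h₂₃₄ : det3 ![x 2, 1, z 2] ![x 3, 1, z 3] ![x 4, 1, z 4] = 0)
    (h₀₁₄ : det3 ![x 0, 1, z 0] ![x 1, 1, z 1] ![x 4, 1, z 4] ≠ 0) :
    (x 0 - x 4) * (x 1 - x 5) * (x 2 - x 3) = (x 0 - x 5) * (x 1 - x 3) * (x 2 - x 4) := by
  rw [det3_affine] at h₀₁₂ h₀₄₅ h₁₃₅ h₂₃₄
  rw [Ne, det3_affine] at h₀₁₄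
  -- Subtract from `z`, up to a scalar, the affine function through the points `0` and `1`.
  let w (t : Fin 6) : ℂ := (x 0 - x 1) * (z t - z 1) - (x 1 - x t) * (z 1 - z 0)
  have e₅₄ : w 5 * (x 0 - x 4) = w 4 * (x 0 - x 5) := by
    linear_combination (x 0 - x 1) * h₀₄₅
  have e₅₃ : w 5 * (x 1 - x 3) = w 3 * (x 1 - x 5) := by
    linear_combination (x 0 - x 1) * h₁₃₅
  have e₄₃ : w 4 * (x 2 - x 3) = w 3 * (x 2 - x 4) := by
    linear_combination (x 0 - x 1) * h₂₃₄ + (x 4 - x 3) * h₀₁₂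
  refine mul_left_cancel₀ (show w 4 ≠ 0 from h₀₁₄) ?_
  linear_combination (x 0 - x 4) * (x 1 - x 5) * e₄₃ - (x 0 - x 4) * (x 2 - x 4) * e₅₃ +
    (x 1 - x 3) * (x 2 - x 4) * e₅₄

/-- Heights over six points of a line that lift them to a quadrilateral set, the points
`0, 1, 2` staying in place. -/
def quadrilateralLift (x : Fin 6 → ℂ) : Fin 6 → ℂ :=
  ![0, 0, 0, (x 5 - x 0) * (x 3 - x 1), (x 5 - x 1) * (x 4 - x 0), (x 5 - x 0) * (x 5 - x 1)]

theorem det3_quadrilateralLift_eq_zero_iff (x : Fin 6 → ℂ) (hx : Function.Injective x)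
    (h : (x 0 - x 4) * (x 1 - x 5) * (x 2 - x 3) = (x 0 - x 5) * (x 1 - x 3) * (x 2 - x 4))
    (a b c : Fin 6) (hab : a < b) (hbc : b < c) :
    det3 ![x a, 1, quadrilateralLift x a] ![x b, 1, quadrilateralLift x b]
        ![x c, 1, quadrilateralLift x c] = 0 ↔
      ({a, b, c} : Finset (Fin 6)) ∈ qsLines := by
  have hne {s t : Fin 6} (hst : s ≠ t) : x s - x t ≠ 0 := sub_ne_zero.2 (hx.ne hst)
  rw [det3_affine]
  obtain ⟨z, hz⟩ : ∃ z, z = quadrilateralLift x := ⟨_, rfl⟩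
  rw [← hz]
  have z₀ : z 0 = 0 := by rw [hz]; rfl
  have z₁ : z 1 = 0 := by rw [hz]; rfl
  have z₂ : z 2 = 0 := by rw [hz]; rfl
  have z₃ : z 3 = (x 5 - x 0) * (x 3 - x 1) := by rw [hz]; rfl
  have z₄ : z 4 = (x 5 - x 1) * (x 4 - x 0) := by rw [hz]; rfl
  have z₅ : z 5 = (x 5 - x 0) * (x 5 - x 1) := by rw [hz]; rfl
  have n₃ : z 3 ≠ 0 := z₃ ▸ mul_ne_zero (hne (by decide)) (hne (by decide))
  have n₄ : z 4 ≠ 0 := z₄ ▸ mul_ne_zero (hne (by decide)) (hne (by decide))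
  have n₅ : z 5 ≠ 0 := z₅ ▸ mul_ne_zero (hne (by decide)) (hne (by decide))
  obtain ⟨u, u₃⟩ : ∃ u, z 3 = u * (x 3 - x 2) :=
    ⟨z 3 / (x 3 - x 2), (div_mul_cancel₀ _ (hne (by decide))).symm⟩
  have u₄ : z 4 = u * (x 4 - x 2) := by
    refine mul_right_cancel₀ (hne (show (3 : Fin 6) ≠ 2 by decide)) ?_
    linear_combination (x 4 - x 2) * u₃ + (x 3 - x 2) * z₄ - (x 4 - x 2) * z₃ - h
  have hu : u ≠ 0 := left_ne_zero_of_mul (u₃ ▸ n₃)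
  -- Two points of the line `0 1 2` and a point off it.
  have two_base {a b c : Fin 6} (ha : z a = 0) (hb : z b = 0) (hc : z c ≠ 0) (hab : a ≠ b) :
      (x a - x b) * (z c - z b) - (x b - x c) * (z b - z a) ≠ 0 := by
    rw [ha, hb]
    simpa using ⟨hne hab, hc⟩
  -- Two points of a line through the base point `d`, and another base point `a`.
  have one_base {a d p q : Fin 6} {s : ℂ} (hs : s ≠ 0) (ha : z a = 0)
      (hp : z p = s * (x p - x d)) (hq : z q = s * (x q - x d)) (had : a ≠ d) (hqp : q ≠ p) :
      (x a - x p) * (z q - z p) - (x p - x q) * (z p - z a) ≠ 0 := by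
    convert mul_ne_zero (mul_ne_zero hs (hne had)) (hne hqp) using 1
    rw [ha, hp, hq]
    ring
  have through_zero {a : Fin 6} (ha : z a = 0) (ha₀ : a ≠ 0) :
      (x a - x 4) * (z 5 - z 4) - (x 4 - x 5) * (z 4 - z a) ≠ 0 :=
    one_base (hne (show (5 : Fin 6) ≠ 1 by decide)) ha z₄ (by rw [z₅]; ring) ha₀ (by decide)
  have through_one {a : Fin 6} (ha : z a = 0) (ha₁ : a ≠ 1) :
      (x a - x 3) * (z 5 - z 3) - (x 3 - x 5) * (z 3 - z a) ≠ 0 :=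
    one_base (hne (show (5 : Fin 6) ≠ 0 by decide)) ha z₃ z₅ ha₁ (by decide)
  have through_two {a : Fin 6} (ha : z a = 0) (ha₂ : a ≠ 2) :
      (x a - x 3) * (z 4 - z 3) - (x 3 - x 4) * (z 3 - z a) ≠ 0 :=
    one_base hu ha u₃ u₄ ha₂ (by decide)
  have no_base : (x 3 - x 4) * (z 5 - z 4) - (x 4 - x 5) * (z 4 - z 3) ≠ 0 := by
    convert mul_ne_zero (mul_ne_zero (hne (show (1 : Fin 6) ≠ 0 by decide))
      (hne (show (5 : Fin 6) ≠ 3 by decide))) (hne (show (5 : Fin 6) ≠ 4 by decide)) using 1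
    rw [z₃, z₄, z₅]
    ring
  by_cases hmem : ({a, b, c} : Finset (Fin 6)) ∈ qsLines
  · refine iff_of_true ?_ hmem
    obtain ⟨rfl, rfl, rfl⟩ | ⟨rfl, rfl, rfl⟩ | ⟨rfl, rfl, rfl⟩ | ⟨rfl, rfl, rfl⟩ :
        (a = 0 ∧ b = 1 ∧ c = 2) ∨ (a = 0 ∧ b = 4 ∧ c = 5) ∨ (a = 1 ∧ b = 3 ∧ c = 5) ∨
          (a = 2 ∧ b = 3 ∧ c = 4) := by
      clear * - hab hbc hmem
      decide +revert
    · rw [z₀, z₁, z₂]; ring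
    · rw [z₀, z₄, z₅]; ring
    · rw [z₁, z₃, z₅]; ring
    · rw [z₂, u₃, u₄]; ring
  · refine iff_of_false ?_ hmem
    have base_eq_zero {t : Fin 6} (ht : t < 3) : z t = 0 := by
      obtain rfl | rfl | rfl : t = 0 ∨ t = 1 ∨ t = 2 := by clear * - ht; decide +revert
      exacts [z₀, z₁, z₂]
    have apex_ne_zero {t : Fin 6} (ht : 3 ≤ t) : z t ≠ 0 := by
      obtain rfl | rfl | rfl : t = 3 ∨ t = 4 ∨ t = 5 := by clear * - ht; decide +revert
      exacts [n₃, n₄, n₅]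
    obtain ⟨hb, hc⟩ | ⟨ha, ha₂, rfl, rfl⟩ | ⟨ha, ha₁, rfl, rfl⟩ | ⟨ha, ha₀, rfl, rfl⟩ |
        ⟨rfl, rfl, rfl⟩ :
        (b < 3 ∧ 3 ≤ c) ∨ (a < 3 ∧ a ≠ 2 ∧ b = 3 ∧ c = 4) ∨ (a < 3 ∧ a ≠ 1 ∧ b = 3 ∧ c = 5) ∨
          (a < 3 ∧ a ≠ 0 ∧ b = 4 ∧ c = 5) ∨ (a = 3 ∧ b = 4 ∧ c = 5) := by
      clear * - hab hbc hmem
      decide +revert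
    · exact two_base (base_eq_zero (hab.trans hb)) (base_eq_zero hb) (apex_ne_zero hc) hab.ne
    · exact through_two (base_eq_zero ha) ha₂
    · exact through_one (base_eq_zero ha) ha₁
    · exact through_zero (base_eq_zero ha) ha₀
    · exact no_base

/-- Six distinct collinear points `vₜ = (xₜ, 1, 0)` lift to a realisation of the
quadrilateral set iff the ten polynomials `QS(ℓ₁₂₃; eᵢ, eⱼ, e_k)`, `i ≤ j ≤ k`,
vanish. -/
theorem stmt11 (x : Fin 6 → ℂ) (hx : Function.Injective x)
    (v : Fin 6 → Fin 3 → ℂ) (hv : ∀ t, v t = ![x t, 1, 0]) :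
    (∃ z : Fin 6 → ℂ,
      ∀ a b c : Fin 6, a ≠ b → a ≠ c → b ≠ c →
        (det3 ![x a, 1, z a] ![x b, 1, z b] ![x c, 1, z c] = 0 ↔
          ({a, b, c} : Finset (Fin 6)) ∈ qsLines)) ↔
    (∀ i j k : Fin 3, i ≤ j → j ≤ k →
      det3 (v 0) (v 4) (stdBasis i) * det3 (v 1) (v 5) (stdBasis j) *
          det3 (v 2) (v 3) (stdBasis k) -
        det3 (v 0) (v 5) (stdBasis i) * det3 (v 1) (v 3) (stdBasis j) *
          det3 (v 2) (v 4) (stdBasis k) = 0) := by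
  rw [forall_qs_eq_zero_iff x v hv]
  constructor
  · rintro ⟨z, hz⟩
    apply quadrilateral_eq_of_lift x z
    · exact (hz 0 1 2 (by decide) (by decide) (by decide)).2 (by decide)
    · exact (hz 0 4 5 (by decide) (by decide) (by decide)).2 (by decide)
    · exact (hz 1 3 5 (by decide) (by decide) (by decide)).2 (by decide)
    · exact (hz 2 3 4 (by decide) (by decide) (by decide)).2 (by decide)
    · exact (hz 0 1 4 (by decide) (by decide) (by decide)).not.2 (by decide)
  · intro h
    refine ⟨quadrilateralLift x, forall_distinct_of_forall_lt ?_ ?_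
      (det3_quadrilateralLift_eq_zero_iff x hx h)⟩
    · intro a b c habc
      rw [det3_swap_left, neg_eq_zero, Finset.insert_comm, habc]
    · intro a b c habc
      rw [det3_swap_right, neg_eq_zero, Finset.pair_comm, habc]
end
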